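/- Let r > 1 and let L_1,…,L_{2r} be distinct lines in ℙ² over an algebraically closed field K such that no point lies on three or more of the lines (t_k = 0 for k > 2), and let Z = p_1+⋯+p_s be the reduced scheme of the s = C(2r,2) crossing points of the lines. Then dim_K [I(mZ)]_{mr} = 0 for all odd m > 0 and dim_K [I(mZ)]_{mr} = 1 for all even m > 0; consequently α̂(I(Z)) = r. -/

import Mathlib

open MvPolynomial

noncomputable section

/-- The ideal of polynomials vanishing on the affine cone over the projective point
with homogeneous coordinate vector `p` (i.e. all forms whose homogeneous components
vanish at `p`, for an infinite field). -/
def coneIdeal (K : Type*) [Field K] {n : ℕ} (p : Fin n → K) :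
    Ideal (MvPolynomial (Fin n) K) where
  carrier := {f | ∀ t : K, eval (t • p) f = 0}
  add_mem' := by
    intro a b ha hb t
    simp only [Set.mem_setOf_eq] at ha hb ⊢
    simp [map_add, ha t, hb t]
  zero_mem' := by
    intro t
    simp
  smul_mem' := by
    intro c f hf t
    simp only [Set.mem_setOf_eq] at hf ⊢
    simp [smul_eq_mul, map_mul, hf t]

/-- The degree-`t` homogeneous component of an ideal, as a `K`-vector subspace. -/
def homComp (K : Type*) [Field K] {n : ℕ} (I : Ideal (MvPolynomial (Fin n) K)) (t : ℕ) :
    Submodule K (MvPolynomial (Fin n) K) :=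
  (Submodule.restrictScalars K I) ⊓ homogeneousSubmodule (Fin n) K t

/-- `α(I)` : the least degree `t` such that `[I]_t ≠ 0`. -/
def alphaDeg (K : Type*) [Field K] {n : ℕ} (I : Ideal (MvPolynomial (Fin n) K)) : ℕ :=
  sInf {t : ℕ | homComp K I t ≠ ⊥}

/-- The ideal of the fat point scheme `Z = m_1 p_1 + ⋯ + m_s p_s`. -/
def fatIdeal (K : Type*) [Field K] {n s : ℕ} (p : Fin s → (Fin n → K)) (m : Fin s → ℕ) :
    Ideal (MvPolynomial (Fin n) K) :=
  ⨅ i, (coneIdeal K (p i)) ^ (m i)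

/-- The `k`-th symbolic power `I(kZ)` of the fat point ideal. -/
def symbPow (K : Type*) [Field K] {n s : ℕ} (p : Fin s → (Fin n → K)) (m : Fin s → ℕ)
    (k : ℕ) : Ideal (MvPolynomial (Fin n) K) :=
  fatIdeal K p (fun i => k * m i)

/-- The Waldschmidt constant `α̂(I(Z)) = inf_{k ≥ 1} α(I(kZ))/k`. -/
def waldschmidt (K : Type*) [Field K] {n s : ℕ} (p : Fin s → (Fin n → K)) (m : Fin s → ℕ) :
    ℝ :=
  ⨅ k : ℕ+, (alphaDeg K (symbPow K p m k) : ℝ) / (k : ℝ)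

/-- The vectors `p i` represent distinct points of projective space. -/
def ProjDistinct (K : Type*) [Field K] {n s : ℕ} (p : Fin s → (Fin n → K)) : Prop :=
  (∀ i, p i ≠ 0) ∧ ∀ i j, i ≠ j → ∀ c : K, p i ≠ c • p j


section StarHelpers

variable {K : Type*} [Field K]

def lin (L : Fin 3 → K) : MvPolynomial (Fin 3) K := ∑ a, C (L a) * X a

lemma eval_lin (L v : Fin 3 → K) : eval v (lin L) = ∑ a, L a * v a := by
  simp [lin]

lemma lin_hom (L : Fin 3 → K) : (lin L).IsHomogeneous 1 :=
  IsHomogeneous.sum _ _ _ fun _ _ => isHomogeneous_C_mul_X _ _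

lemma lin_ne (L : Fin 3 → K) (h : L ≠ 0) : lin L ≠ 0 := by
  intro h0
  apply h
  funext a
  have := congrArg (eval (Pi.single a 1)) h0
  simpa [eval_lin, Pi.single_apply] using this

def phi (v : Fin 3 → K) :
    MvPolynomial (Fin 3) K →ₐ[K] Polynomial (MvPolynomial (Fin 3) K) :=
  aeval (fun i => Polynomial.C (C (v i)) + Polynomial.X * Polynomial.C (X i))

lemma phi_lin (v L : Fin 3 → K) : phi v (lin L) =
    Polynomial.C (C (∑ a, L a * v a)) + Polynomial.X * Polynomial.C (lin L) := by
  simp [phi, lin, Fin.sum_univ_three, algebraMap_eq, Polynomial.algebraMap_apply]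
  ring

lemma phi_coeff (v : Fin 3 → K) (f : MvPolynomial (Fin 3) K) :
    (phi v f).coeff 0 = C (eval v f) := by
  induction f using MvPolynomial.induction_on with
  | C a => simp [phi, algebraMap_eq, Polynomial.algebraMap_apply]
  | add p q hp hq => simp [hp, hq]
  | mul_X p i hp =>
    rw [map_mul, Polynomial.mul_coeff_zero, hp]
    simp [phi]

lemma phi_pow_mem (v p : Fin 3 → K) (c : K) (hv : v = c • p) (m : ℕ)
    (f : MvPolynomial (Fin 3) K) (hf : f ∈ coneIdeal K p ^ m) :
    (Polynomial.X : Polynomial (MvPolynomial (Fin 3) K)) ^ m ∣ phi v f := by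
  have h1 : (coneIdeal K p).map ((phi v).toRingHom) ≤
      Ideal.span {Polynomial.X} := by
    rw [Ideal.map_le_iff_le_comap]
    intro g hg
    rw [Ideal.mem_comap, Ideal.mem_span_singleton, Polynomial.X_dvd_iff]
    have := phi_coeff v g
    rw [hv, hg c, ← hv] at this
    simpa using this
  have h2 := Ideal.mem_map_of_mem ((phi v).toRingHom) hf
  rw [Ideal.map_pow] at h2
  have h3 := Ideal.pow_right_mono h1 m h2
  rw [Ideal.span_singleton_pow, Ideal.mem_span_singleton] at h3
  exact h3

def psi (L w : Fin 3 → K) : MvPolynomial (Fin 3) K →ₐ[K] MvPolynomial (Fin 3) K :=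
  aeval (fun i => X i - C (w i) * lin L)

lemma psi_sub (L w : Fin 3 → K) (f : MvPolynomial (Fin 3) K) : lin L ∣ f - psi L w f := by
  induction f using MvPolynomial.induction_on with
  | C a => simp [psi, algebraMap_eq]
  | add p q hp hq =>
    rw [map_add, add_sub_add_comm]
    exact dvd_add hp hq
  | mul_X p i hp =>
    obtain ⟨k, hk⟩ := hp
    rw [map_mul]
    refine ⟨k * X i + psi L w p * C (w i), ?_⟩
    have : psi L w (X i) = X i - C (w i) * lin L := by simp [psi]
    rw [this]
    linear_combination X i * hk

lemma psi_eval (L w : Fin 3 → K) (f : MvPolynomial (Fin 3) K) (v : Fin 3 → K) :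
    eval v (psi L w f) = eval (fun i => v i - w i * ∑ a, L a * v a) f := by
  induction f using MvPolynomial.induction_on with
  | C a => simp [psi, algebraMap_eq]
  | add p q hp hq => simp [hp, hq]
  | mul_X p i hp => simp [hp]; left; simp [psi, eval_lin]

lemma psi_lin (L w M : Fin 3 → K) :
    psi L w (lin M) = lin (fun a => M a - (∑ b, M b * w b) * L a) := by
  simp [psi, lin, Fin.sum_univ_three, algebraMap_eq]
  ring

lemma exists_dot_one (L : Fin 3 → K) (h : L ≠ 0) : ∃ w : Fin 3 → K, ∑ a, L a * w a = 1 := by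
  obtain ⟨a, ha⟩ := Function.ne_iff.mp h
  refine ⟨Pi.single a (L a)⁻¹, ?_⟩
  simp [Pi.single_apply]
  exact mul_inv_cancel₀ ha

lemma psi_iff (L w : Fin 3 → K) (h : ∑ a, L a * w a = 1) (f : MvPolynomial (Fin 3) K) :
    lin L ∣ f ↔ psi L w f = 0 := by
  constructor
  · rintro ⟨g, rfl⟩
    rw [map_mul, psi_lin, h]
    simp [lin]
  · intro h0
    have := psi_sub L w f
    rwa [h0, sub_zero] at this

lemma lin_dvd_of_vanish [Infinite K] (L : Fin 3 → K) (h : L ≠ 0) (f : MvPolynomial (Fin 3) K)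
    (hf : ∀ y : Fin 3 → K, ∑ a, L a * y a = 0 → eval y f = 0) : lin L ∣ f := by
  obtain ⟨w, hw⟩ := exists_dot_one L h
  rw [psi_iff L w hw]
  apply MvPolynomial.funext
  intro v
  rw [psi_eval, map_zero]
  apply hf
  simp only [mul_sub, Finset.sum_sub_distrib]
  rw [sub_eq_zero]
  simp only [← mul_assoc, ← Finset.sum_mul, hw, one_mul]

lemma lin_dvd_mul (L : Fin 3 → K) (h : L ≠ 0) (f g : MvPolynomial (Fin 3) K)
    (hfg : lin L ∣ f * g) : lin L ∣ f ∨ lin L ∣ g := by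
  obtain ⟨w, hw⟩ := exists_dot_one L h
  simp only [psi_iff L w hw] at *
  simpa using hfg

lemma lin_dvd_lin (L M : Fin 3 → K) (h : L ≠ 0) (hd : lin L ∣ lin M) : ∃ c : K, M = c • L := by
  obtain ⟨w, hw⟩ := exists_dot_one L h
  rw [psi_iff L w hw, psi_lin] at hd
  refine ⟨∑ b, M b * w b, ?_⟩
  by_contra hne
  refine lin_ne _ ?_ hd
  intro h0
  apply hne
  funext a
  have := congrFun h0 a
  simpa [sub_eq_zero] using this

lemma prod_lin_dvd {ι : Type*} [DecidableEq ι] (S : Finset ι) (L : ι → Fin 3 → K)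
    (hL0 : ∀ i, L i ≠ 0) (hLdist : ∀ i j, i ≠ j → ∀ c : K, L i ≠ c • L j)
    (f : MvPolynomial (Fin 3) K) (hf : ∀ i, lin (L i) ∣ f) : ∏ i ∈ S, lin (L i) ∣ f := by
  induction S using Finset.induction_on with
  | empty => simp
  | insert i S hi ih =>
    obtain ⟨g, hg⟩ := ih
    rw [Finset.prod_insert hi]
    have h1 := hf i
    rw [hg] at h1
    rcases lin_dvd_mul _ (hL0 i) _ _ h1 with h2 | h2
    · exfalso
      have : ∀ T : Finset ι, i ∉ T → ¬ lin (L i) ∣ ∏ i ∈ T, lin (L i) := by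
        intro T
        induction T using Finset.induction_on with
        | empty =>
          intro _ h
          obtain ⟨w, hw⟩ := exists_dot_one (L i) (hL0 i)
          rw [psi_iff _ w hw] at h
          simp at h
        | insert j T hj ihT =>
          intro hiT h
          rw [Finset.prod_insert hj] at h
          simp only [Finset.mem_insert, not_or] at hiT
          rcases lin_dvd_mul _ (hL0 i) _ _ h with h | h
          · obtain ⟨c, hc⟩ := lin_dvd_lin _ _ (hL0 i) h
            exact hLdist j i (Ne.symm hiT.1) c hc
          · exact ihT hiT.2 h
      exact this S hi h2
    · rw [hg, mul_comm]
      exact mul_dvd_mul_left _ h2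

lemma hom_of_mul (F P G : MvPolynomial (Fin 3) K) (t d : ℕ) (hF : F.IsHomogeneous t)
    (hP : P.IsHomogeneous d) (h : F = P * G) (hF0 : F ≠ 0) :
    d ≤ t ∧ G.IsHomogeneous (t - d) := by
  have hP0 : P ≠ 0 := by rintro rfl; simp at h; exact hF0 h
  have hG0 : G ≠ 0 := by rintro rfl; simp at h; exact hF0 h
  have hdt : d ≤ t := by
    have := totalDegree_mul_of_isDomain hP0 hG0
    rw [← h, hF.totalDegree hF0, hP.totalDegree hP0] at this
    omega
  refine ⟨hdt, ?_⟩
  let _ : GradedAlgebra (homogeneousSubmodule (Fin 3) K) := MvPolynomial.gradedAlgebra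
  have h1 := DirectSum.coe_decompose_mul_of_left_mem_of_le (homogeneousSubmodule (Fin 3) K)
    (a := P) (b := G) hP hdt
  rw [← h, DirectSum.decompose_of_mem_same _ hF, h] at h1
  have h2 := mul_left_cancel₀ hP0 h1
  rw [h2]
  exact (DirectSum.decompose (homogeneousSubmodule (Fin 3) K) G (t - d)).2

def ple (q0 q1 : Fin 3 → K) : MvPolynomial (Fin 3) K →ₐ[K] Polynomial K :=
  aeval (fun i => Polynomial.C (q0 i) + Polynomial.X * Polynomial.C (q1 i))

lemma ple_eval (q0 q1 : Fin 3 → K) (f : MvPolynomial (Fin 3) K) (x : K) :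
    (ple q0 q1 f).eval x = eval (q0 + x • q1) f := by
  induction f using MvPolynomial.induction_on with
  | C a => simp [ple]
  | add p q hp hq => simp [hp, hq]
  | mul_X p i hp => simp [hp]; left; simp [ple]; ring

lemma ple_deg (q0 q1 : Fin 3 → K) (f : MvPolynomial (Fin 3) K) :
    (ple q0 q1 f).natDegree ≤ f.totalDegree := by
  rw [ple, aeval_def, eval₂_eq]
  apply Polynomial.natDegree_sum_le_of_forall_le
  intro d hd
  refine (Polynomial.natDegree_C_mul_le _ _).trans ?_
  refine (Polynomial.natDegree_prod_le _ _).trans ?_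
  refine le_trans ?_ (le_totalDegree hd)
  rw [Finsupp.sum]
  apply Finset.sum_le_sum
  intro i _
  refine Polynomial.natDegree_pow_le.trans ?_
  have : (Polynomial.C (q0 i) + Polynomial.X * Polynomial.C (q1 i)).natDegree ≤ 1 := by
    compute_degree
  nlinarith

lemma ple_phi (q0 q1 : Fin 3 → K) (x : K) (m : ℕ) (f : MvPolynomial (Fin 3) K)
    (h : Polynomial.X ^ m ∣ phi (q0 + x • q1) f) :
    (Polynomial.X - Polynomial.C x) ^ m ∣ ple q0 q1 f := by
  let θ : Polynomial (MvPolynomial (Fin 3) K) →+* Polynomial K :=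
    Polynomial.eval₂RingHom (Polynomial.C.comp (eval q1)) (Polynomial.X - Polynomial.C x)
  have h1 := map_dvd θ h
  have h2 : θ (phi (q0 + x • q1) f) = ple q0 q1 f := by
    clear h h1
    induction f using MvPolynomial.induction_on with
    | C a => simp [ple, phi, θ, algebraMap_eq, Polynomial.algebraMap_apply]
    | add p q hp hq => simp [hp, hq]
    | mul_X p i hp =>
      rw [map_mul, map_mul, map_mul, hp]
      congr 1
      simp [ple, phi, θ]
      ring
  rw [h2] at h1
  simpa [θ] using h1

def cr (u v : Fin 3 → K) : Fin 3 → K :=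
  ![u 1 * v 2 - u 2 * v 1, u 2 * v 0 - u 0 * v 2, u 0 * v 1 - u 1 * v 0]

lemma cr_ne (u v : Fin 3 → K) (hv : v ≠ 0) (h : ∀ c : K, u ≠ c • v) : cr u v ≠ 0 := by
  intro h0
  have e0 := congrFun h0 0
  have e1 := congrFun h0 1
  have e2 := congrFun h0 2
  simp [cr] at e0 e1 e2
  obtain ⟨a, ha⟩ := Function.ne_iff.mp hv
  simp only [Pi.zero_apply] at ha
  apply h (u a / v a)
  funext b
  simp only [Pi.smul_apply, smul_eq_mul]
  rw [div_mul_eq_mul_div, eq_div_iff ha]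
  fin_cases a <;> fin_cases b <;> simp <;> grind

lemma cr_perp (u v y : Fin 3 → K) (h : cr u v ≠ 0) (hu : ∑ a, u a * y a = 0)
    (hv : ∑ a, v a * y a = 0) : ∃ c : K, y = c • cr u v := by
  obtain ⟨a, ha⟩ := Function.ne_iff.mp h
  simp only [Pi.zero_apply] at ha
  refine ⟨y a / cr u v a, ?_⟩
  funext b
  simp only [Pi.smul_apply, smul_eq_mul]
  rw [div_mul_eq_mul_div, eq_div_iff ha]
  simp only [Fin.sum_univ_three] at hu hv
  clear ha h
  fin_cases a <;> fin_cases b <;> simp [cr] <;> grind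

lemma hom_eval_smul (F : MvPolynomial (Fin 3) K) (t : ℕ) (hF : F.IsHomogeneous t) (c : K)
    (v : Fin 3 → K) (h : eval v F = 0) : eval (c • v) F = 0 := by
  have : eval (c • v) F = c ^ t * eval v F := by
    rw [eval_eq, eval_eq, Finset.mul_sum]
    apply Finset.sum_congr rfl
    intro d hd
    have hdeg := hF.degree_eq_sum_deg_support hd
    simp only [Pi.smul_apply, smul_eq_mul, mul_pow, Finset.prod_mul_distrib,
      Finset.prod_pow_eq_pow_sum]
    rw [hdeg]
    ring
  rw [this, h, mul_zero]

lemma line_dvd [Infinite K] {n : ℕ} (hn : 2 ≤ n) (L : Fin n → (Fin 3 → K))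
    (hL0 : ∀ i, L i ≠ 0)
    (hLdist : ∀ i j, i ≠ j → ∀ c : K, L i ≠ c • L j)
    (ht2 : ∀ v : Fin 3 → K, v ≠ 0 →
      ¬ ∃ i j l : Fin n, i ≠ j ∧ i ≠ l ∧ j ≠ l ∧
        (∑ a, L i a * v a = 0) ∧ (∑ a, L j a * v a = 0) ∧ (∑ a, L l a * v a = 0))
    (m t : ℕ) (F : MvPolynomial (Fin 3) K) (hF : F.IsHomogeneous t)
    (hM : ∀ v : Fin 3 → K, v ≠ 0 →
      (∃ i j : Fin n, i ≠ j ∧ (∑ b, L i b * v b = 0) ∧ (∑ b, L j b * v b = 0)) →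
      Polynomial.X ^ m ∣ phi v F)
    (htm : t < m * (n - 1)) (i : Fin n) : lin (L i) ∣ F := by
  have hcr : ∀ j, j ≠ i → cr (L i) (L j) ≠ 0 := fun j hj =>
    cr_ne _ _ (hL0 j) (hLdist i j hj.symm)
  obtain ⟨w, hw⟩ : ∃ w : Fin 3 → K, ∀ j, j ≠ i → ∑ a, cr (L i) (L j) a * w a ≠ 0 := by
    by_contra hcon
    push Not at hcon
    have : ∏ j ∈ Finset.univ.erase i, lin (cr (L i) (L j)) = 0 := by
      apply MvPolynomial.funext
      intro w
      obtain ⟨j, hj, h0⟩ := hcon w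
      rw [map_prod, map_zero]
      exact Finset.prod_eq_zero (Finset.mem_erase.mpr ⟨hj, Finset.mem_univ _⟩)
        (by rw [eval_lin, h0])
    rw [Finset.prod_eq_zero_iff] at this
    obtain ⟨j, hj, h0⟩ := this
    exact lin_ne _ (hcr j (Finset.ne_of_mem_erase hj)) h0
  set q1 := cr w (L i) with hq1
  have hq1i : ∑ a, L i a * q1 a = 0 := by
    simp [Fin.sum_univ_three, hq1, cr]; ring
  have hq1j : ∀ j, j ≠ i → ∑ a, L j a * q1 a ≠ 0 := by
    intro j hj h0
    apply hw j hj
    rw [← h0]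
    simp [Fin.sum_univ_three, hq1, cr]; ring
  obtain ⟨j0, hj0⟩ : ∃ j0, j0 ≠ i := by
    haveI : Nontrivial (Fin n) := Fin.nontrivial_iff_two_le.mpr hn
    exact exists_ne i
  set q0 := cr (L i) (L j0) with hq0
  have hq0i : ∑ a, L i a * q0 a = 0 := by
    simp [Fin.sum_univ_three, hq0, cr]; ring
  have hq0j : ∑ a, L j0 a * q0 a = 0 := by
    simp [Fin.sum_univ_three, hq0, cr]; ring
  have hdot : ∀ (M : Fin 3 → K) (a b : K), ∑ k, M k * (a • q0 + b • q1) k =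
      a * ∑ k, M k * q0 k + b * ∑ k, M k * q1 k := by
    intro M a b
    simp only [Fin.sum_univ_three, Pi.add_apply, Pi.smul_apply, smul_eq_mul]
    ring
  have hq00 : q0 ≠ 0 := hcr j0 hj0
  have hdot1 : ∀ (M : Fin 3 → K) (b : K), ∑ k, M k * (q0 + b • q1) k =
      ∑ k, M k * q0 k + b * ∑ k, M k * q1 k := by
    intro M b
    simpa using hdot M 1 b
  have hne : ∀ x : K, q0 + x • q1 ≠ 0 := by
    intro x h0
    have h1 := hdot1 (L j0) x
    rw [h0, hq0j] at h1
    simp only [Pi.zero_apply, mul_zero, Finset.sum_const_zero, zero_add] at h1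
    have hx : x = 0 := by
      rcases mul_eq_zero.mp h1.symm with h | h
      · exact h
      · exact absurd h (hq1j j0 hj0)
    rw [hx] at h0
    simp at h0
    exact hq00 h0
  let x : Fin n → K := fun j => - (∑ k, L j k * q0 k) / ∑ k, L j k * q1 k
  have hxj : ∀ j, j ≠ i → ∑ k, L j k * (q0 + x j • q1) k = 0 := by
    intro j hj
    rw [hdot1]
    simp only [x]
    rw [div_mul_cancel₀ _ (hq1j j hj)]
    ring
  have hxi : ∀ b : K, ∑ k, L i k * (q0 + b • q1) k = 0 := by
    intro b
    rw [hdot1, hq0i, hq1i]; ring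
  have hdvd : ∀ j, j ≠ i → (Polynomial.X - Polynomial.C (x j)) ^ m ∣ ple q0 q1 F := by
    intro j hj
    apply ple_phi
    exact hM _ (hne _) ⟨i, j, hj.symm, hxi _, hxj j hj⟩
  have hprod : ∏ j ∈ Finset.univ.erase i, (Polynomial.X - Polynomial.C (x j)) ^ m ∣
      ple q0 q1 F := by
    apply Finset.prod_dvd_of_coprime
    · intro j hj l hl hjl
      have hj' := Finset.ne_of_mem_erase (Finset.mem_coe.mp hj)
      have hl' := Finset.ne_of_mem_erase (Finset.mem_coe.mp hl)
      apply IsCoprime.pow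
      apply Polynomial.isCoprime_X_sub_C_of_isUnit_sub
      apply IsUnit.mk0
      rw [sub_ne_zero]
      intro hx
      refine ht2 _ (hne (x j)) ⟨i, j, l, hj'.symm, hl'.symm, hjl, hxi _, hxj j hj', ?_⟩
      rw [hx]
      exact hxj l hl'
    · intro j hj
      exact hdvd j (Finset.ne_of_mem_erase hj)
  have hzero : ple q0 q1 F = 0 := by
    by_contra h0
    have h1 := Polynomial.natDegree_le_of_dvd hprod h0
    have h2 : (∏ j ∈ Finset.univ.erase i, (Polynomial.X - Polynomial.C (x j)) ^ m).natDegree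
        = m * (n - 1) := by
      rw [Polynomial.natDegree_prod_of_monic _ _
        (fun j _ => (Polynomial.monic_X_sub_C _).pow _)]
      simp [Finset.card_erase_of_mem, mul_comm]
    have h3 := (ple_deg q0 q1 F).trans hF.totalDegree_le
    omega
  have hv1 : ∀ a b : K, a ≠ 0 → eval (a • q0 + b • q1) F = 0 := by
    intro a b ha
    have h1 := ple_eval q0 q1 F (b / a)
    rw [hzero, Polynomial.eval_zero] at h1
    have h2 := hom_eval_smul F t hF a _ h1.symm
    rwa [smul_add, smul_smul, mul_div_cancel₀ _ ha] at h2
  have hv2 : ∀ a b : K, eval (a • q0 + b • q1) F = 0 := by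
    intro a b
    have hp : (Polynomial.X : Polynomial K) * ple (b • q1) q0 F = 0 := by
      apply Polynomial.funext
      intro c
      rw [Polynomial.eval_mul, Polynomial.eval_X, ple_eval, Polynomial.eval_zero]
      by_cases hc : c = 0
      · simp [hc]
      · rw [add_comm, hv1 c b hc, mul_zero]
    have hp2 : ple (b • q1) q0 F = 0 := by
      rcases mul_eq_zero.mp hp with h | h
      · exact absurd h Polynomial.X_ne_zero
      · exact h
    have := ple_eval (b • q1) q0 F a
    rw [hp2, Polynomial.eval_zero, add_comm] at this
    exact this.symm
  apply lin_dvd_of_vanish _ (hL0 i)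
  intro y hy
  obtain ⟨b, hb⟩ : ∃ b : K, b * ∑ k, L j0 k * q1 k = ∑ k, L j0 k * y k :=
    ⟨_, div_mul_cancel₀ _ (hq1j j0 hj0)⟩
  have hsub : ∀ M : Fin 3 → K, ∑ k, M k * (y - b • q1) k =
      ∑ k, M k * y k - b * ∑ k, M k * q1 k := by
    intro M
    simp only [Fin.sum_univ_three, Pi.sub_apply, Pi.smul_apply, smul_eq_mul]
    ring
  obtain ⟨c, hc⟩ := cr_perp (L i) (L j0) (y - b • q1) hq00
    (by rw [hsub, hy, hq1i]; ring) (by rw [hsub, hb]; ring)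
  rw [← hq0, sub_eq_iff_eq_add] at hc
  rw [hc]
  exact hv2 c b

lemma not_X_dvd_phi (v L : Fin 3 → K) (h : ∑ a, L a * v a ≠ 0) :
    ¬ Polynomial.X ∣ phi v (lin L) := by
  rw [Polynomial.X_dvd_iff, phi_coeff, eval_lin]
  exact fun h0 => h (C_injective _ _ (h0.trans C_0.symm))

lemma phi_descend {n : ℕ} (L : Fin n → (Fin 3 → K))
    (hL0 : ∀ i, L i ≠ 0)
    (v : Fin 3 → K) (i j : Fin n) (hij : i ≠ j)
    (hi : ∑ a, L i a * v a = 0) (hj : ∑ a, L j a * v a = 0)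
    (hk : ∀ k, k ≠ i → k ≠ j → ∑ a, L k a * v a ≠ 0)
    (m : ℕ) (G : MvPolynomial (Fin 3) K)
    (h : Polynomial.X ^ (m + 2) ∣ phi v ((∏ k, lin (L k)) * G)) :
    Polynomial.X ^ m ∣ phi v G := by
  have hXp : Prime (Polynomial.X : Polynomial (MvPolynomial (Fin 3) K)) := Polynomial.prime_X
  rw [← Finset.mul_prod_erase _ _ (Finset.mem_univ i),
    ← Finset.mul_prod_erase _ _ (Finset.mem_erase.mpr ⟨hij.symm, Finset.mem_univ j⟩),
    map_mul, map_mul, map_mul, phi_lin, phi_lin, hi, hj, map_prod] at h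
  set R := ∏ k ∈ (Finset.univ.erase i).erase j, phi v (lin (L k)) with hR
  have hR1 : ¬ Polynomial.X ∣ R := by
    intro hd
    obtain ⟨k, hk1, hk2⟩ := hXp.exists_mem_finset_dvd hd
    simp only [Finset.mem_erase, Finset.mem_univ, and_true] at hk1
    exact not_X_dvd_phi v (L k) (hk k hk1.2 hk1.1) hk2
  have hC : ∀ k, ¬ Polynomial.X ∣ Polynomial.C (lin (L k)) := by
    intro k
    rw [Polynomial.X_dvd_iff, Polynomial.coeff_C_zero]
    exact lin_ne _ (hL0 k)
  have h2 : (Polynomial.X : Polynomial (MvPolynomial (Fin 3) K)) ^ 2 * Polynomial.X ^ m ∣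
      Polynomial.X ^ 2 *
      (Polynomial.C (lin (L i)) * (Polynomial.C (lin (L j)) * (R * phi v G))) := by
    convert h using 1
    · ring
    · simp only [map_zero]; ring
  have h3 := (mul_dvd_mul_iff_left (pow_ne_zero 2 Polynomial.X_ne_zero)).mp h2
  have h4 := hXp.pow_dvd_of_dvd_mul_left m (hC i) h3
  have h5 := hXp.pow_dvd_of_dvd_mul_left m (hC j) h4
  exact hXp.pow_dvd_of_dvd_mul_left m hR1 h5

lemma prod_lin_hom {n : ℕ} (L : Fin n → (Fin 3 → K)) : (∏ k, lin (L k)).IsHomogeneous n := by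
  have := IsHomogeneous.prod Finset.univ (fun k => lin (L k)) (fun _ => 1)
    (fun k _ => lin_hom (L k))
  simpa using this

lemma star_main [Infinite K] (r : ℕ) (hr : 1 < r) (L : Fin (2 * r) → (Fin 3 → K))
    (hL0 : ∀ i, L i ≠ 0)
    (hLdist : ∀ i j, i ≠ j → ∀ c : K, L i ≠ c • L j)
    (ht2 : ∀ v : Fin 3 → K, v ≠ 0 →
      ¬ ∃ i j l : Fin (2 * r), i ≠ j ∧ i ≠ l ∧ j ≠ l ∧
        (∑ a, L i a * v a = 0) ∧ (∑ a, L j a * v a = 0) ∧ (∑ a, L l a * v a = 0))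
    (m : ℕ) : ∀ (t : ℕ) (F : MvPolynomial (Fin 3) K), F.IsHomogeneous t → F ≠ 0 →
    (∀ v : Fin 3 → K, v ≠ 0 →
      (∃ i j : Fin (2 * r), i ≠ j ∧ (∑ b, L i b * v b = 0) ∧ (∑ b, L j b * v b = 0)) →
      Polynomial.X ^ m ∣ phi v F) → t ≤ m * r →
    t = m * r ∧ ∃ e, m = 2 * e ∧ ∃ c : K, F = C c * (∏ k, lin (L k)) ^ e := by
  induction m using Nat.strong_induction_on with
  | _ m ih =>
    intro t F hF hF0 hM ht
    rcases Nat.eq_zero_or_pos m with rfl | hm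
    · have h0 : t = 0 := by omega
      subst h0
      refine ⟨by simp, 0, rfl, coeff 0 F, ?_⟩
      rw [pow_zero, mul_one]
      exact totalDegree_eq_zero_iff_eq_C.mp (hF.totalDegree hF0)
    have hlt : t < m * (2 * r - 1) :=
      lt_of_le_of_lt ht (Nat.mul_lt_mul_of_pos_left (by omega) hm)
    have hd := prod_lin_dvd Finset.univ L hL0 hLdist F
      (line_dvd (by omega) L hL0 hLdist ht2 m t F hF hM hlt)
    obtain ⟨G, hG⟩ := hd
    obtain ⟨hdeg, hGh⟩ := hom_of_mul F _ G t (2 * r) hF (prod_lin_hom L) hG hF0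
    have hG0 : G ≠ 0 := by rintro rfl; simp at hG; exact hF0 hG
    obtain ⟨m', rfl⟩ : ∃ m', m = m' + 2 := by
      refine ⟨m - 2, ?_⟩
      by_contra hcon
      have : m = 1 := by omega
      subst this
      omega
    have := ih m' (by omega) (t - 2 * r) G hGh hG0 (by
      intro v hv hvij
      have h1 := hM v hv hvij
      obtain ⟨i, j, hij, hi, hj⟩ := hvij
      rw [hG] at h1
      refine phi_descend L hL0 v i j hij hi hj ?_ m' G h1
      intro k hki hkj hk
      exact ht2 v hv ⟨i, j, k, hij, hki.symm, hkj.symm, hi, hj, hk⟩)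
      (by rw [add_mul] at ht; omega)
    obtain ⟨h1, e, he, c, hc⟩ := this
    refine ⟨by rw [add_mul]; omega, e + 1, by omega, c, ?_⟩
    rw [hG, hc]
    ring

lemma symb_phi {s : ℕ} (p : Fin s → (Fin 3 → K)) (k : ℕ) (F : MvPolynomial (Fin 3) K)
    (hF : F ∈ symbPow K p (fun _ => 1) k) (v : Fin 3 → K) (a : Fin s) (c : K)
    (hv : v = c • p a) : Polynomial.X ^ k ∣ phi v F := by
  simp only [symbPow, fatIdeal, mul_one, Ideal.mem_iInf] at hF
  exact phi_pow_mem v (p a) c hv k F (hF a)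

lemma star_prod_mem {n s : ℕ} (L : Fin n → (Fin 3 → K)) (p : Fin s → (Fin 3 → K))
    (hcross : ∀ a, ∃ i j : Fin n, i ≠ j ∧
      (∑ b, L i b * p a b = 0) ∧ (∑ b, L j b * p a b = 0)) (e k : ℕ) (hk : k ≤ 2 * e) :
    (∏ k, lin (L k)) ^ e ∈ symbPow K p (fun _ => 1) k := by
  simp only [symbPow, fatIdeal, mul_one, Ideal.mem_iInf]
  intro a
  apply Ideal.pow_le_pow_right hk
  rw [pow_mul]
  apply Ideal.pow_mem_pow
  obtain ⟨i, j, hij, hi, hj⟩ := hcross a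
  have hc : ∀ i, ∑ b, L i b * p a b = 0 → lin (L i) ∈ coneIdeal K (p a) := by
    intro i hi t
    rw [eval_lin]
    have : ∑ b, L i b * (t • p a) b = t * ∑ b, L i b * p a b := by
      simp only [Fin.sum_univ_three, Pi.smul_apply, smul_eq_mul]; ring
    rw [this, hi, mul_zero]
  rw [← Finset.mul_prod_erase _ _ (Finset.mem_univ i),
    ← Finset.mul_prod_erase _ _ (Finset.mem_erase.mpr ⟨hij.symm, Finset.mem_univ j⟩),
    ← mul_assoc]
  apply Ideal.mul_mem_right
  rw [pow_two]
  exact Ideal.mul_mem_mul (hc i hi) (hc j hj)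

end StarHelpers

set_option maxHeartbeats 1000000 in
/-- Let `r > 1` and let `L_1, …, L_{2r}` be distinct lines in `ℙ²` (encoded by nonzero
pairwise non-proportional coefficient vectors) with no point on three or more lines,
and let `Z = p_1 + ⋯ + p_s` be the reduced scheme of the `s = C(2r,2)` crossing points.
Then `dim [I(kZ)]_{kr} = 0` for odd `k > 0` and `= 1` for even `k > 0`; hence
`α̂(I(Z)) = r`. -/
theorem star_configuration (K : Type*) [Field K] [IsAlgClosed K]
    (r : ℕ) (hr : 1 < r)
    (L : Fin (2 * r) → (Fin 3 → K))
    (hL0 : ∀ i, L i ≠ 0)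
    (hLdist : ∀ i j, i ≠ j → ∀ c : K, L i ≠ c • L j)
    (ht2 : ∀ v : Fin 3 → K, v ≠ 0 →
      ¬ ∃ i j l : Fin (2 * r), i ≠ j ∧ i ≠ l ∧ j ≠ l ∧
        (∑ a, L i a * v a = 0) ∧ (∑ a, L j a * v a = 0) ∧ (∑ a, L l a * v a = 0))
    (s : ℕ) (hs : s = (2 * r).choose 2)
    (p : Fin s → (Fin 3 → K)) (hp : ProjDistinct K p)
    (hcross : ∀ a, ∃ i j : Fin (2 * r), i ≠ j ∧
      (∑ b, L i b * p a b = 0) ∧ (∑ b, L j b * p a b = 0))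
    (hall : ∀ v : Fin 3 → K, v ≠ 0 →
      (∃ i j : Fin (2 * r), i ≠ j ∧ (∑ b, L i b * v b = 0) ∧ (∑ b, L j b * v b = 0)) →
      ∃ a, ∃ c : K, v = c • p a) :
    (∀ k : ℕ, 0 < k → Odd k →
      Module.finrank K ↥(homComp K (symbPow K p (fun _ => 1) k) (k * r)) = 0) ∧
    (∀ k : ℕ, 0 < k → Even k →
      Module.finrank K ↥(homComp K (symbPow K p (fun _ => 1) k) (k * r)) = 1) ∧
    waldschmidt K p (fun _ => 1) = (r : ℝ) := by
  have hP0 : (∏ k, lin (L k)) ≠ 0 := Finset.prod_ne_zero_iff.mpr fun i _ => lin_ne _ (hL0 i)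
  have key : ∀ (k t : ℕ) (F : MvPolynomial (Fin 3) K), F ∈ homComp K (symbPow K p (fun _ => 1) k) t →
      F ≠ 0 → t ≤ k * r →
      t = k * r ∧ ∃ e, k = 2 * e ∧ ∃ c : K, F = C c * (∏ k, lin (L k)) ^ e := by
    intro k t F hF hF0 ht
    refine star_main r hr L hL0 hLdist ht2 k t F hF.2 hF0 ?_ ht
    intro v hv hvij
    obtain ⟨a, c, hc⟩ := hall v hv hvij
    exact symb_phi p k F hF.1 v a c hc
  have hmem : ∀ e k : ℕ, k ≤ 2 * e →
      (∏ k, lin (L k)) ^ e ∈ homComp K (symbPow K p (fun _ => 1) k) (2 * r * e) := by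
    intro e k hk
    exact ⟨star_prod_mem L p hcross e k hk, (prod_lin_hom L).pow e⟩
  refine ⟨?_, ?_, ?_⟩
  · intro k hk hodd
    have : homComp K (symbPow K p (fun _ => 1) k) (k * r) = ⊥ := by
      rw [Submodule.eq_bot_iff]
      intro F hF
      by_contra hF0
      obtain ⟨-, e, he, -⟩ := key k _ F hF hF0 le_rfl
      obtain ⟨d, hd⟩ := hodd
      omega
    rw [this]
    exact finrank_bot K _
  · intro k hk heven
    obtain ⟨e, he⟩ := heven
    have hke : k = 2 * e := by omega
    have : homComp K (symbPow K p (fun _ => 1) k) (k * r) =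
        Submodule.span K {(∏ k, lin (L k)) ^ e} := by
      apply le_antisymm
      · intro F hF
        by_cases hF0 : F = 0
        · rw [hF0]; exact Submodule.zero_mem _
        obtain ⟨-, e', he', c, hc⟩ := key k _ F hF hF0 le_rfl
        have : e' = e := by omega
        subst this
        rw [Submodule.mem_span_singleton]
        exact ⟨c, by rw [hc, smul_eq_C_mul]⟩
      · rw [Submodule.span_singleton_le_iff_mem]
        have := hmem e k (by omega)
        rwa [show 2 * r * e = k * r by rw [hke]; ring] at this
    rw [this]
    exact finrank_span_singleton (pow_ne_zero _ hP0)
  · have hne : ∀ e k : ℕ, k ≤ 2 * e →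
        2 * r * e ∈ {t : ℕ | homComp K (symbPow K p (fun _ => 1) k) t ≠ ⊥} := by
      intro e k hk h0
      have := hmem e k hk
      rw [h0, Submodule.mem_bot] at this
      exact pow_ne_zero _ hP0 this
    have hlow : ∀ k : ℕ, k * r ≤ alphaDeg K (symbPow K p (fun _ => 1) k) := by
      intro k
      have hs := Nat.sInf_mem ⟨_, hne k k (by omega)⟩
      change homComp K _ (alphaDeg K (symbPow K p (fun _ => 1) k)) ≠ ⊥ at hs
      obtain ⟨F, hF, hF0⟩ := Submodule.exists_mem_ne_zero_of_ne_bot hs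
      by_contra hlt
      have := (key k _ F hF hF0 (by omega)).1
      omega
    have hlow' : ∀ k : ℕ+, (r : ℝ) ≤
        (alphaDeg K (symbPow K p (fun _ => 1) k) : ℝ) / (k : ℝ) := by
      intro k
      have hk : (0 : ℝ) < ((k : ℕ) : ℝ) := by exact_mod_cast k.pos
      rw [le_div_iff₀ hk, mul_comm]
      exact_mod_cast hlow k
    unfold waldschmidt
    apply le_antisymm
    · refine ciInf_le_of_le ⟨(r : ℝ), ?_⟩ (2 : ℕ+) ?_
      · rintro _ ⟨k, rfl⟩
        exact hlow' k
      · have h2 : alphaDeg K (symbPow K p (fun _ => 1) 2) ≤ 2 * r * 1 :=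
          Nat.sInf_le (hne 1 2 (by omega))
        have h3 : (((2 : ℕ+) : ℕ) : ℝ) = 2 := by norm_num
        rw [h3, div_le_iff₀ (by norm_num)]
        have h4 : ((2 : ℕ+) : ℕ) = 2 := rfl
        rw [h4]
        have h5 : (alphaDeg K (symbPow K p (fun _ => 1) 2) : ℝ) ≤ ((2 * r * 1 : ℕ) : ℝ) := by
          exact_mod_cast h2
        push_cast at h5
        linarith
    · exact le_ciInf hlow'

end
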